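/- Let n be a natural number, w : Fin n → ℕ, v : Fin n → ℝ with v i ≥ 0, and let u be a positive natural number dividing w i for every i. Then for every capacity c : ℕ, the optimal knapsack value with weights w and capacity c equals the optimal knapsack value with scaled weights w' i = w i / u and capacity ⌊c / u⌋. (Rescaling the unit of shelf space does not change the optimum, justifying the capacity-scaling used to reduce the effective size of the dynamic program.) -/

import Mathlib

/-- Optimal value of the binary knapsack problem with item set `Fin n` and
capacity `c`. -/
noncomputable def knapOPT {n : ℕ} (w : Fin n → ℕ) (v : Fin n → ℝ) (c : ℕ) : ℝ :=
  ((Finset.univ.powerset.filter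
      (fun S : Finset (Fin n) => ∑ k ∈ S, w k ≤ c)).sup'
    ⟨∅, by simp⟩ (fun S => ∑ k ∈ S, v k))

/-- Dividing every weight by a common divisor `u` and the capacity by `u` (rounding down)
preserves the feasibility of each set of items. -/
theorem sum_div_le_div_iff_of_dvd {ι : Type*} {w : ι → ℕ} {u : ℕ} (hu : 0 < u)
    (hdvd : ∀ i, u ∣ w i) (S : Finset ι) (c : ℕ) :
    ∑ k ∈ S, w k / u ≤ c / u ↔ ∑ k ∈ S, w k ≤ c := by
  rw [Nat.le_div_iff_mul_le hu, Finset.sum_mul,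
    Finset.sum_congr rfl fun k _ => Nat.div_mul_cancel (hdvd k)]

/-- Rescaling the unit of shelf space does not change the knapsack optimum:
if a positive unit `u` divides every weight, then the optimal value with
weights `w` and capacity `c` equals the optimal value with scaled weights
`w i / u` and capacity `⌊c / u⌋`. -/
theorem knapsack_opt_unit_rescaling (n : ℕ) (w : Fin n → ℕ) (v : Fin n → ℝ)
    (hv : ∀ i, 0 ≤ v i) (u : ℕ) (hu : 0 < u) (hdvd : ∀ i, u ∣ w i) (c : ℕ) :
    knapOPT w v c = knapOPT (fun i => w i / u) v (c / u) := by
  unfold knapOPT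
  refine Finset.sup'_congr _ (Finset.filter_congr fun S _ => ?_) fun _ _ => rfl
  exact (sum_div_le_div_iff_of_dvd hu hdvd S c).symm
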